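/- Let θ > 0 be a real number. Then ∑_{n=2}^{∞} L( sinh²(θ) / sinh²(nθ) ) = L( e^{-2θ} ). -/

import Mathlib

/-- The Rogers dilogarithm on `[0,1]`: `L(x) = Li₂(x) + (1/2)·log x · log (1-x)`
for `0 < x < 1`, with `L 0 = 0` and `L 1 = π²/6`. -/
noncomputable def rogersL (x : ℝ) : ℝ :=
  if x = 0 then 0
  else if x = 1 then Real.pi ^ 2 / 6
  else (∑' n : ℕ, x ^ (n + 1) / ((n : ℝ) + 1) ^ 2) + 1 / 2 * Real.log x * Real.log (1 - x)

open Filter Topology Set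

theorem hasDerivAt_tsum_pow_div_sq {x : ℝ} (hx : |x| < 1) :
    HasDerivAt (fun y : ℝ => ∑' n : ℕ, y ^ (n + 1) / ((n : ℝ) + 1) ^ 2)
      (∑' n : ℕ, x ^ n / ((n : ℝ) + 1)) x := by
  obtain ⟨r, hxr, hr⟩ := exists_between hx
  have hr0 : 0 ≤ r := (abs_nonneg x).trans hxr.le
  refine hasDerivAt_tsum_of_isPreconnected (u := fun n : ℕ => r ^ n) (t := Ioo (-r) r) (y₀ := 0)
    (g := fun n y => y ^ (n + 1) / ((n : ℝ) + 1) ^ 2) (g' := fun n y => y ^ n / ((n : ℝ) + 1))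
    (summable_geometric_of_lt_one hr0 hr) isOpen_Ioo isPreconnected_Ioo ?_ ?_ ?_ ?_ ?_
  · intro n y _
    have h := (hasDerivAt_pow (n + 1) y).div_const (((n : ℝ) + 1) ^ 2)
    refine h.congr_deriv ?_
    have : (n : ℝ) + 1 ≠ 0 := by positivity
    rw [Nat.add_sub_cancel]
    push_cast
    field_simp
  · intro n y hy
    have hy' : |y| ≤ r := (abs_lt.2 hy).le
    have h1 : (1 : ℝ) ≤ (n : ℝ) + 1 := by simp
    rw [Real.norm_eq_abs, abs_div, abs_pow, abs_of_pos (by positivity : (0 : ℝ) < n + 1)]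
    calc |y| ^ n / ((n : ℝ) + 1) ≤ |y| ^ n := div_le_self (by positivity) h1
      _ ≤ r ^ n := by gcongr
  · have := (abs_nonneg x).trans_lt hxr
    exact ⟨by linarith, this⟩
  · simp
  · exact abs_lt.1 hxr

theorem tsum_pow_div_succ {x : ℝ} (h0 : 0 < x) (h1 : x < 1) :
    ∑' n : ℕ, x ^ n / ((n : ℝ) + 1) = -Real.log (1 - x) / x := by
  have h := (Real.hasSum_pow_div_log_of_abs_lt_one (abs_lt.2 ⟨by linarith, h1⟩)).div_const x
  rw [← h.tsum_eq]
  refine tsum_congr fun n => ?_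
  have : (n : ℝ) + 1 ≠ 0 := by positivity
  field_simp
  ring

theorem rogersL_of_mem_Ioo {x : ℝ} (hx : x ∈ Ioo (0 : ℝ) 1) :
    rogersL x = (∑' n : ℕ, x ^ (n + 1) / ((n : ℝ) + 1) ^ 2)
      + 1 / 2 * Real.log x * Real.log (1 - x) := by
  rw [rogersL, if_neg hx.1.ne', if_neg hx.2.ne]

theorem rogersL_nonneg {x : ℝ} (hx : x ∈ Ioo (0 : ℝ) 1) : 0 ≤ rogersL x := by
  rw [rogersL_of_mem_Ioo hx]
  have hs : 0 ≤ ∑' n : ℕ, x ^ (n + 1) / ((n : ℝ) + 1) ^ 2 :=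
    tsum_nonneg fun n => by have := hx.1; positivity
  have h1 := Real.log_nonpos hx.1.le hx.2.le
  have h2 := Real.log_nonpos (x := 1 - x) (by linarith [hx.2]) (by linarith [hx.1])
  nlinarith [mul_nonneg_of_nonpos_of_nonpos h1 h2]

theorem hasDerivAt_rogersL {x : ℝ} (hx : x ∈ Ioo (0 : ℝ) 1) :
    HasDerivAt rogersL (-(1 / 2) * (Real.log (1 - x) / x + Real.log x / (1 - x))) x := by
  have h0 := hx.1
  have h1 : 0 < 1 - x := by linarith [hx.2]
  have hd := hasDerivAt_tsum_pow_div_sq (abs_lt.2 ⟨by linarith, hx.2⟩)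
  rw [tsum_pow_div_succ hx.1 hx.2] at hd
  have hl := (Real.hasDerivAt_log h0.ne').const_mul (1 / 2)
  have hl' := ((hasDerivAt_id x).const_sub 1).log h1.ne'
  have h := hd.add (hl.mul hl')
  refine (h.congr_of_eventuallyEq ?_).congr_deriv ?_
  · filter_upwards [isOpen_Ioo.mem_nhds hx] with y hy
    exact rogersL_of_mem_Ioo hy
  · simp only [id]
    field_simp
    ring

theorem continuousAt_rogersL {x : ℝ} (hx : x ∈ Ioo (0 : ℝ) 1) : ContinuousAt rogersL x :=
  (hasDerivAt_rogersL hx).continuousAt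

theorem tendsto_rogersL_nhdsGT_zero : Tendsto rogersL (𝓝[>] 0) (𝓝 0) := by
  have hs : Tendsto (fun y : ℝ => ∑' n : ℕ, y ^ (n + 1) / ((n : ℝ) + 1) ^ 2) (𝓝[>] 0) (𝓝 0) := by
    have h := (hasDerivAt_tsum_pow_div_sq (x := 0) (by simp)).continuousAt.tendsto
    simp only [zero_pow (Nat.succ_ne_zero _), zero_div, tsum_zero] at h
    exact h.mono_left nhdsWithin_le_nhds
  have hq : Tendsto (fun y : ℝ => y⁻¹ * Real.log (1 - y)) (𝓝[>] 0) (𝓝 (-1)) := by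
    have h := ((hasDerivAt_id (0 : ℝ)).const_sub 1).log (by simp)
    have h' := h.tendsto_slope_zero_right
    simpa using h'
  have hx : Tendsto (fun y : ℝ => Real.log y * y) (𝓝[>] 0) (𝓝 0) :=
    by simpa only [Real.rpow_one] using tendsto_log_mul_rpow_nhdsGT_zero zero_lt_one
  have h := hs.add ((hx.mul hq).const_mul (1 / 2))
  rw [zero_mul, mul_zero, add_zero] at h
  refine h.congr' ?_
  filter_upwards [Ioo_mem_nhdsGT (zero_lt_one (α := ℝ))] with y hy
  rw [rogersL_of_mem_Ioo hy]
  have := hy.1.ne'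
  field_simp

theorem eq_of_hasDerivAt_zero_Ioo {f : ℝ → ℝ}
    (hf : ∀ x ∈ Ioo (0 : ℝ) 1, HasDerivAt f 0 x) {x y : ℝ}
    (hx : x ∈ Ioo (0 : ℝ) 1) (hy : y ∈ Ioo (0 : ℝ) 1) : f x = f y :=
  isOpen_Ioo.is_const_of_deriv_eq_zero isPreconnected_Ioo
    (fun z hz => (hf z hz).differentiableAt.differentiableWithinAt)
    (fun z hz => (hf z hz).deriv) hx hy

theorem rogersL_add_rogersL_one_sub {x y : ℝ} (hx : x ∈ Ioo (0 : ℝ) 1) (hy : y ∈ Ioo (0 : ℝ) 1) :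
    rogersL x + rogersL (1 - x) = rogersL y + rogersL (1 - y) := by
  refine eq_of_hasDerivAt_zero_Ioo (f := fun x => rogersL x + rogersL (1 - x)) ?_ hx hy
  intro z hz
  have hz' : 1 - z ∈ Ioo (0 : ℝ) 1 := ⟨by linarith [hz.2], by linarith [hz.1]⟩
  have h := (hasDerivAt_rogersL hz).add
    ((hasDerivAt_rogersL hz').comp z ((hasDerivAt_id z).const_sub 1))
  refine h.congr_deriv ?_
  rw [sub_sub_cancel]
  ring

section FiveTerm

variable {x y : ℝ}

theorem mul_mem_Ioo_zero_one (hx : x ∈ Ioo (0 : ℝ) 1) (hy : y ∈ Ioo (0 : ℝ) 1) :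
    x * y ∈ Ioo (0 : ℝ) 1 :=
  ⟨mul_pos hx.1 hy.1, mul_lt_one_of_nonneg_of_lt_one_left hx.1.le hx.2 hy.2.le⟩

theorem mul_one_sub_div_mem_Ioo (hx : x ∈ Ioo (0 : ℝ) 1) (hy : y ∈ Ioo (0 : ℝ) 1) :
    x * (1 - y) / (1 - x * y) ∈ Ioo (0 : ℝ) 1 := by
  have h : 0 < 1 - x * y := by linarith [(mul_mem_Ioo_zero_one hx hy).2]
  have hy' : 0 < 1 - y := by linarith [hy.2]
  refine ⟨div_pos (mul_pos hx.1 hy') h, ?_⟩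
  rw [div_lt_one h]
  nlinarith [hx.2]

theorem rogersL_five_term (hx : x ∈ Ioo (0 : ℝ) 1) (hy : y ∈ Ioo (0 : ℝ) 1) :
    rogersL x + rogersL y = rogersL (x * y) + rogersL (x * (1 - y) / (1 - x * y))
      + rogersL (y * (1 - x) / (1 - x * y)) := by
  set f : ℝ → ℝ := fun x => rogersL x + rogersL y - (rogersL (x * y)
    + rogersL (x * (1 - y) / (1 - x * y)) + rogersL (y * (1 - x) / (1 - x * y))) with hf
  have hd : ∀ z ∈ Ioo (0 : ℝ) 1, HasDerivAt f 0 z := by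
    intro z hz
    have m1 := mul_mem_Ioo_zero_one hz hy
    have m2 := mul_one_sub_div_mem_Ioo hz hy
    have m3 := mul_one_sub_div_mem_Ioo hy hz
    rw [mul_comm y z] at m3
    have z0 : 0 < z := hz.1
    have y0 : 0 < y := hy.1
    have z1 : 0 < 1 - z := by linarith [hz.2]
    have y1 : 0 < 1 - y := by linarith [hy.2]
    have d0 : 0 < 1 - z * y := by linarith [m1.2]
    have i := hasDerivAt_id z
    have e1 := i.mul_const y
    have e2 := (i.mul_const (1 - y)).div (e1.const_sub 1) d0.ne'
    have e3 := ((i.const_sub 1).const_mul y).div (e1.const_sub 1) d0.ne'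
    have h := ((hasDerivAt_rogersL hz).add_const (rogersL y)).sub
      ((((hasDerivAt_rogersL m1).comp z e1).add ((hasDerivAt_rogersL m2).comp z e2)).add
        ((hasDerivAt_rogersL m3).comp z e3))
    refine h.congr_deriv ?_
    have s2 : 1 - z * (1 - y) / (1 - z * y) = (1 - z) / (1 - z * y) := by
      field_simp; ring
    have s3 : 1 - y * (1 - z) / (1 - z * y) = (1 - y) / (1 - z * y) := by
      rw [one_sub_div d0.ne']; ring
    simp only [id]
    rw [s2, s3, Real.log_div z1.ne' d0.ne', Real.log_div y1.ne' d0.ne',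
      Real.log_div (mul_pos z0 y1).ne' d0.ne', Real.log_div (mul_pos y0 z1).ne' d0.ne',
      Real.log_mul z0.ne' y1.ne', Real.log_mul y0.ne' z1.ne', Real.log_mul z0.ne' y0.ne']
    generalize Real.log z = a
    generalize Real.log y = b
    generalize Real.log (1 - z) = c
    generalize Real.log (1 - y) = d
    generalize Real.log (1 - z * y) = e
    field_simp
    ring
  have hlim : Tendsto f (𝓝[>] 0) (𝓝 0) := by
    have hmem : ∀ᶠ z : ℝ in 𝓝[>] 0, z ∈ Ioo (0 : ℝ) 1 := Ioo_mem_nhdsGT zero_lt_one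
    have t1 : Tendsto (fun z : ℝ => rogersL (z * y)) (𝓝[>] 0) (𝓝 0) := by
      refine tendsto_rogersL_nhdsGT_zero.comp (tendsto_nhdsWithin_iff.2 ⟨?_, ?_⟩)
      · have : ContinuousAt (fun z : ℝ => z * y) 0 := by fun_prop
        simpa using this.tendsto.mono_left nhdsWithin_le_nhds
      · filter_upwards [hmem] with z hz using (mul_mem_Ioo_zero_one hz hy).1
    have t2 : Tendsto (fun z : ℝ => rogersL (z * (1 - y) / (1 - z * y))) (𝓝[>] 0) (𝓝 0) := by
      refine tendsto_rogersL_nhdsGT_zero.comp (tendsto_nhdsWithin_iff.2 ⟨?_, ?_⟩)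
      · have : ContinuousAt (fun z : ℝ => z * (1 - y) / (1 - z * y)) 0 := by
          refine ContinuousAt.div (by fun_prop) (by fun_prop) (by simp)
        simpa using this.tendsto.mono_left nhdsWithin_le_nhds
      · filter_upwards [hmem] with z hz using (mul_one_sub_div_mem_Ioo hz hy).1
    have t3 : Tendsto (fun z : ℝ => rogersL (y * (1 - z) / (1 - z * y))) (𝓝[>] 0)
        (𝓝 (rogersL y)) := by
      refine (continuousAt_rogersL hy).tendsto.comp ?_
      have : ContinuousAt (fun z : ℝ => y * (1 - z) / (1 - z * y)) 0 := by
        refine ContinuousAt.div (by fun_prop) (by fun_prop) (by simp)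
      simpa using this.tendsto.mono_left nhdsWithin_le_nhds
    simpa using (tendsto_rogersL_nhdsGT_zero.add_const (rogersL y)).sub ((t1.add t2).add t3)
  have hconst : Tendsto f (𝓝[>] 0) (𝓝 (f x)) := by
    refine tendsto_const_nhds.congr' ?_
    filter_upwards [Ioo_mem_nhdsGT (zero_lt_one (α := ℝ))] with z hz
    exact eq_of_hasDerivAt_zero_Ioo hd hx hz
  have h0 : f x = 0 := tendsto_nhds_unique hconst hlim
  simp only [hf] at h0
  linarith

end FiveTerm

section Telescoping

variable {q : ℝ}

theorem one_sub_div_one_sub_pow_mem_Ioo (hq : q ∈ Ioo (0 : ℝ) 1) (n : ℕ) :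
    (1 - q) / (1 - q ^ (n + 2)) ∈ Ioo (0 : ℝ) 1 := by
  have h1 : 0 < 1 - q := by linarith [hq.2]
  have hlt : q ^ (n + 2) < q := pow_lt_self_of_lt_one₀ hq.1 hq.2 (by omega)
  have h2 : 0 < 1 - q ^ (n + 2) := by linarith
  exact ⟨div_pos h1 h2, (div_lt_one h2).2 (by linarith)⟩

theorem pow_succ_mem_Ioo (hq : q ∈ Ioo (0 : ℝ) 1) (n : ℕ) : q ^ (n + 1) ∈ Ioo (0 : ℝ) 1 :=
  ⟨pow_pos hq.1 _, pow_lt_one₀ hq.1.le hq.2 (by omega)⟩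

theorem rogersL_telescope (hq : q ∈ Ioo (0 : ℝ) 1) (n : ℕ) :
    rogersL (q ^ (n + 1) * ((1 - q) / (1 - q ^ (n + 2))) * ((1 - q) / (1 - q ^ (n + 2)))) =
      (rogersL (q ^ (n + 1) * ((1 - q) / (1 - q ^ (n + 2))))
        + rogersL ((1 - q) / (1 - q ^ (n + 2))))
      - (rogersL (q ^ (n + 2) * ((1 - q) / (1 - q ^ (n + 3))))
        + rogersL ((1 - q) / (1 - q ^ (n + 3)))) := by
  have hW := one_sub_div_one_sub_pow_mem_Ioo hq n
  have hT := mul_mem_Ioo_zero_one (pow_succ_mem_Ioo hq n) hW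
  have h := rogersL_five_term hT hW
  have p1 : 0 < 1 - q ^ (n + 1) := by linarith [(pow_succ_mem_Ioo hq n).2]
  have p2 : 0 < 1 - q ^ (n + 2) := by linarith [(pow_succ_mem_Ioo hq (n + 1)).2]
  have p3 : 0 < 1 - q ^ (n + 3) := by linarith [(pow_succ_mem_Ioo hq (n + 2)).2]
  have hs : 1 - q ^ (n + 1) * ((1 - q) / (1 - q ^ (n + 2))) * ((1 - q) / (1 - q ^ (n + 2)))
      = (1 - q ^ (n + 1)) * (1 - q ^ (n + 3)) / (1 - q ^ (n + 2)) ^ 2 := by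
    field_simp
    ring
  have hW' : 1 - (1 - q) / (1 - q ^ (n + 2)) = q * (1 - q ^ (n + 1)) / (1 - q ^ (n + 2)) := by
    field_simp
    ring
  have hT' : 1 - q ^ (n + 1) * ((1 - q) / (1 - q ^ (n + 2)))
      = (1 - q ^ (n + 1)) / (1 - q ^ (n + 2)) := by
    field_simp
    ring
  have r1 : q ^ (n + 1) * ((1 - q) / (1 - q ^ (n + 2))) * (1 - (1 - q) / (1 - q ^ (n + 2)))
      / (1 - q ^ (n + 1) * ((1 - q) / (1 - q ^ (n + 2))) * ((1 - q) / (1 - q ^ (n + 2))))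
      = q ^ (n + 2) * ((1 - q) / (1 - q ^ (n + 3))) := by
    rw [hs, hW']
    field_simp
    ring
  have r2 : (1 - q) / (1 - q ^ (n + 2)) * (1 - q ^ (n + 1) * ((1 - q) / (1 - q ^ (n + 2))))
      / (1 - q ^ (n + 1) * ((1 - q) / (1 - q ^ (n + 2))) * ((1 - q) / (1 - q ^ (n + 2))))
      = (1 - q) / (1 - q ^ (n + 3)) := by
    rw [hs, hT']
    field_simp
  rw [r1, r2] at h
  linarith

theorem hasSum_rogersL_pow (hq : q ∈ Ioo (0 : ℝ) 1) :
    HasSum (fun n : ℕ => rogersL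
      (q ^ (n + 1) * ((1 - q) / (1 - q ^ (n + 2))) * ((1 - q) / (1 - q ^ (n + 2)))))
      (rogersL q) := by
  set P : ℕ → ℝ := fun n => rogersL (q ^ (n + 1) * ((1 - q) / (1 - q ^ (n + 2))))
    + rogersL ((1 - q) / (1 - q ^ (n + 2))) with hP
  have hT (n : ℕ) := mul_mem_Ioo_zero_one (pow_succ_mem_Ioo hq n)
    (one_sub_div_one_sub_pow_mem_Ioo hq n)
  have hq' : 1 - q ∈ Ioo (0 : ℝ) 1 := ⟨by linarith [hq.2], by linarith [hq.1]⟩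
  rw [hasSum_iff_tendsto_nat_of_nonneg fun n => rogersL_nonneg
    (mul_mem_Ioo_zero_one (hT n) (one_sub_div_one_sub_pow_mem_Ioo hq n))]
  have hsum (N : ℕ) : ∑ n ∈ Finset.range N, rogersL
      (q ^ (n + 1) * ((1 - q) / (1 - q ^ (n + 2))) * ((1 - q) / (1 - q ^ (n + 2))))
      = P 0 - P N := by
    rw [← Finset.sum_range_sub' P N]
    exact Finset.sum_congr rfl fun n _ => rogersL_telescope hq n
  have hpow (k : ℕ) : Tendsto (fun n : ℕ => q ^ (n + k)) atTop (𝓝 0) :=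
    (tendsto_add_atTop_iff_nat k).2 (tendsto_pow_atTop_nhds_zero_of_lt_one hq.1.le hq.2)
  have hW : Tendsto (fun n : ℕ => (1 - q) / (1 - q ^ (n + 2))) atTop (𝓝 (1 - q)) := by
    have h := (tendsto_const_nhds (x := 1 - q)).div ((hpow 2).const_sub 1) (by simp)
    rwa [sub_zero, div_one] at h
  have hlim : Tendsto P atTop (𝓝 (0 + rogersL (1 - q))) := by
    refine Tendsto.add ?_ ((continuousAt_rogersL hq').tendsto.comp hW)
    refine tendsto_rogersL_nhdsGT_zero.comp (tendsto_nhdsWithin_iff.2 ⟨?_, ?_⟩)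
    · simpa using (hpow 1).mul hW
    · exact Eventually.of_forall fun n => (hT n).1
  have h0 : P 0 = rogersL q + rogersL (1 - q) := by
    have e : 1 - q ^ 1 * ((1 - q) / (1 - q ^ 2)) = (1 - q) / (1 - q ^ 2) := by
      have : 0 < 1 - q ^ 2 := sub_pos.2 (pow_succ_mem_Ioo hq 1).2
      field_simp
      ring
    rw [← rogersL_add_rogersL_one_sub (hT 0) hq]
    simp only [hP, zero_add, e]
  simp only [hsum]
  simpa [h0] using hlim.const_sub (P 0)

end Telescoping

theorem sinh_sq_div_sinh_sq_eq {θ : ℝ} (hθ : 0 < θ) (n : ℕ) :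
    Real.sinh θ ^ 2 / Real.sinh ((n + 2 : ℕ) * θ) ^ 2 =
      Real.exp (-2 * θ) ^ (n + 1)
        * ((1 - Real.exp (-2 * θ)) / (1 - Real.exp (-2 * θ) ^ (n + 2)))
        * ((1 - Real.exp (-2 * θ)) / (1 - Real.exp (-2 * θ) ^ (n + 2))) := by
  have hq : Real.exp (-2 * θ) = (Real.exp θ ^ 2)⁻¹ := by
    rw [← Real.exp_nat_mul, ← Real.exp_neg]
    push_cast
    ring_nf
  have hE : 1 < Real.exp θ := Real.one_lt_exp_iff.2 hθ
  rw [Real.sinh_eq, Real.sinh_eq, Real.exp_neg, Real.exp_neg, Real.exp_nat_mul, hq]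
  generalize Real.exp θ = E at hE
  have hE0 : 0 < E := by linarith
  have hp : 1 < E ^ (n + 2) := one_lt_pow₀ hE (by omega)
  have hne : (E ^ (n + 2)) ^ 2 - 1 ≠ 0 := by nlinarith
  have e1 : (E ^ (n + 2) - (E ^ (n + 2))⁻¹) = ((E ^ (n + 2)) ^ 2 - 1) / E ^ (n + 2) := by
    field_simp
  have e2 : 1 - (E ^ 2)⁻¹ ^ (n + 2) = ((E ^ (n + 2)) ^ 2 - 1) / (E ^ (n + 2)) ^ 2 := by
    rw [inv_pow, ← pow_mul, mul_comm 2, pow_mul]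
    field_simp
  have e3 : (E ^ 2)⁻¹ ^ (n + 1) = E ^ 2 / (E ^ (n + 2)) ^ 2 := by
    rw [inv_pow]
    field_simp
    ring
  rw [e1, e2, e3]
  generalize E ^ (n + 2) = F at *
  have hF : F ≠ 0 := by linarith
  field_simp

theorem stmt_13 (θ : ℝ) (hθ : 0 < θ) :
    ∑' n : ℕ, rogersL (Real.sinh θ ^ 2 / Real.sinh ((n + 2 : ℕ) * θ) ^ 2) =
      rogersL (Real.exp (-2 * θ)) := by
  simp only [sinh_sq_div_sinh_sq_eq hθ]
  exact (hasSum_rogersL_pow ⟨Real.exp_pos _, Real.exp_lt_one_iff.2 (by linarith)⟩).tsum_eq
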